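/- arXiv:0907.3723 — 2 statements merged into one kernel-verified Lean document; each statement's English description precedes it below -/
import Mathlib

section
/- Let q ≡ 1 (mod 5), let ψ ∈ F_q^*, set λ = ψ^{−5}, and let χ be a multiplicative character of F_q^* of order 5. For a multiplicative character χ' of F_q^* set N(B_ψ,χ') = Σ_{x ∈ F_q, x ≠ 0, x ≠ 1, x ≠ 1/λ} χ'^2(x)·χ'^4(1−x)·χ'^{−4}(1−λx). Then N_{(0,0,1,1,3),χ}(q) = q·N(B_ψ,χ) and N_{(0,0,1,2,2),χ}(q) = q·N(B_ψ,χ^2). -/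
/-- The group of multiplicative characters of a finite field with values in `ℂ` is finite. -/
noncomputable instance {F : Type*} [Field F] [Fintype F] : Fintype (MulChar F ℂ) :=
  Fintype.ofFinite _

/-- The Gauss sum `G(φ, χ) = ∑_{x ∈ F*} φ(x) χ(x)`. -/
noncomputable def gaussSum' {F : Type*} [Field F] [Fintype F]
    (φ : AddChar F ℂ) (χ : MulChar F ℂ) : ℂ :=
  letI := Classical.decEq F
  ∑ x : Fˣ, φ (x : F) * χ (x : F)

/-- `z` is the number of indices `j` such that `χ^{s_j} η` is trivial. -/
noncomputable def zNum {F : Type*} [Field F] [Fintype F]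
    (χ η : MulChar F ℂ) (s : Fin 5 → ℤ) : ℕ :=
  letI := Classical.decEq (MulChar F ℂ)
  (Finset.univ.filter (fun j : Fin 5 => χ ^ s j * η = 1)).card

/-- `δ = 0` if `z ≥ 1` and `δ = 1` if `z = 0`. -/
noncomputable def deltaNum {F : Type*} [Field F] [Fintype F]
    (χ η : MulChar F ℂ) (s : Fin 5 → ℤ) : ℕ :=
  if 1 ≤ zNum χ η s then 0 else 1

/-- `N_{(s₁,…,s₅),χ}(q) = (1/(q-1)) ∑_η q^{5-z-δ} G(φ,η⁵) / (∏_j G(φ,χ^{s_j} η)) η(1/(5ψ)⁵)`. -/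
noncomputable def Ntuple {F : Type*} [Field F] [Fintype F]
    (φ : AddChar F ℂ) (χ : MulChar F ℂ) (ψ : F) (s : Fin 5 → ℤ) : ℂ :=
  (1 / ((Fintype.card F : ℂ) - 1)) *
    ∑ η : MulChar F ℂ,
      (Fintype.card F : ℂ) ^ ((5 : ℤ) - zNum χ η s - deltaNum χ η s) *
        gaussSum' φ (η ^ 5) / (∏ j : Fin 5, gaussSum' φ (χ ^ s j * η)) *
        η ((((5 : F) * ψ) ^ 5)⁻¹)

/-- `N(B_ψ, χ') = ∑_{x ≠ 0, 1, 1/λ} χ'^{e₁}(x) χ'^{e₂}(1-x) χ'^{-e₂}(1-λx)`. -/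
noncomputable def NcurvePsi {F : Type*} [Field F] [Fintype F] (e₁ e₂ : ℕ)
    (lam : F) (χ' : MulChar F ℂ) : ℂ :=
  letI := Classical.decEq F
  ∑ x ∈ Finset.univ.filter (fun x : F => x ≠ 0 ∧ x ≠ 1 ∧ x ≠ lam⁻¹),
    (χ' ^ e₁) x * (χ' ^ e₂) (1 - x) * (χ' ^ (-(e₂ : ℤ))) (1 - lam * x)

section MonicPolynomials

open Polynomial UniqueFactorizationMonoid

variable {F : Type*} [Field F] [Fintype F]

theorem finite_setOf_monic_natDegree_eq (F : Type*) [Field F] [Fintype F] (n : ℕ) :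
    {f : F[X] | f.Monic ∧ f.natDegree = n}.Finite := by
  refine Set.Finite.of_finite_image (f := fun f : F[X] => fun i : Fin (n + 1) => f.coeff i)
    (Set.toFinite _) ?_
  rintro f ⟨-, hf⟩ g ⟨-, hg⟩ h
  ext i
  rcases lt_or_ge i (n + 1) with hi | hi
  · exact congrFun h ⟨i, hi⟩
  · rw [coeff_eq_zero_of_natDegree_lt (by omega), coeff_eq_zero_of_natDegree_lt (by omega)]

/-- The finite set of monic polynomials of degree `n` over a finite field. -/
noncomputable def monicFinset (F : Type*) [Field F] [Fintype F] (n : ℕ) : Finset F[X] :=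
  (finite_setOf_monic_natDegree_eq F n).toFinset

theorem mem_monicFinset {n : ℕ} {f : F[X]} :
    f ∈ monicFinset F n ↔ f.Monic ∧ f.natDegree = n := by
  simp [monicFinset]

open Classical in
/-- The monic irreducible polynomials whose degree divides `k`. -/
noncomputable def primeFinset (F : Type*) [Field F] [Fintype F] (k : ℕ) : Finset F[X] :=
  (k.divisors.biUnion (monicFinset F)).filter Irreducible

theorem mem_primeFinset {k : ℕ} (hk : k ≠ 0) {P : F[X]} :
    P ∈ primeFinset F k ↔ P.Monic ∧ Irreducible P ∧ P.natDegree ∣ k := by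
  simp only [primeFinset, Finset.mem_filter, Finset.mem_biUnion, Nat.mem_divisors,
    mem_monicFinset]
  constructor
  · rintro ⟨⟨d, ⟨hd, -⟩, hm, rfl⟩, hi⟩
    exact ⟨hm, hi, hd⟩
  · rintro ⟨hm, hi, hd⟩
    exact ⟨⟨_, ⟨hd, hk⟩, hm, rfl⟩, hi⟩

theorem card_filter_dvd_div_le {d c n : ℕ} (hd : 0 < d) (h : c * d ≤ n) :
    ((Finset.Icc 1 n).filter fun k => d ∣ k ∧ k / d ≤ c).card = c := by
  have : (Finset.Icc 1 n).filter (fun k => d ∣ k ∧ k / d ≤ c) =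
      (Finset.Icc 1 c).image (· * d) := by
    ext k
    simp only [Finset.mem_filter, Finset.mem_Icc, Finset.mem_image]
    constructor
    · rintro ⟨⟨h1, -⟩, ⟨j, rfl⟩, hj⟩
      rw [Nat.mul_div_cancel_left _ hd] at hj
      exact ⟨j, ⟨Nat.pos_of_mul_pos_left h1, hj⟩, mul_comm _ _⟩
    · rintro ⟨j, ⟨h1, hj⟩, rfl⟩
      refine ⟨⟨Nat.mul_pos h1 hd, (Nat.mul_le_mul_right d hj).trans h⟩, dvd_mul_left _ _, ?_⟩
      rwa [Nat.mul_div_cancel _ hd]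
  rw [this, Finset.card_image_of_injective _ fun a b h => Nat.eq_of_mul_eq_mul_right hd h,
    Nat.card_Icc]
  rfl

open Classical in
theorem sum_natDegree_primeFinset_pow_dvd {n : ℕ} {f : F[X]} (hf : f ∈ monicFinset F n) :
    ∑ k ∈ Finset.Icc 1 n, ∑ P ∈ (primeFinset F k).filter
      (fun P => P ^ (k / P.natDegree) ∣ f), P.natDegree = n := by
  obtain ⟨hm, hn⟩ := mem_monicFinset.1 hf
  have h0 : f ≠ 0 := hm.ne_zero
  have hmem : ∀ P : F[X], P ∈ normalizedFactors f ↔ P.Monic ∧ Irreducible P ∧ P ∣ f := by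
    intro P
    constructor
    · intro h
      have hi := irreducible_of_normalized_factor P h
      refine ⟨?_, hi, dvd_of_mem_normalizedFactors h⟩
      rw [← normalize_normalized_factor P h]
      exact monic_normalize hi.ne_zero
    · rintro ⟨h1, h2, h3⟩
      rw [mem_normalizedFactors_iff' h0]
      exact ⟨h2, h1.normalize_eq_self, h3⟩
  have hsum : ∑ P ∈ (normalizedFactors f).toFinset,
      (normalizedFactors f).count P * P.natDegree = n := by
    have h1 : (normalizedFactors f).prod = f := by
      rw [prod_normalizedFactors_eq h0, hm.normalize_eq_self]
    have h2 := natDegree_multiset_prod (normalizedFactors f) (zero_notMem_normalizedFactors f)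
    rw [h1, hn, Finset.sum_multiset_map_count] at h2
    simpa using h2.symm
  have hcount : ∀ P ∈ (normalizedFactors f).toFinset, ∀ j,
      P ^ j ∣ f ↔ j ≤ (normalizedFactors f).count P := by
    intro P hP j
    obtain ⟨h1, h2, h3⟩ := (hmem P).1 (Multiset.mem_toFinset.1 hP)
    rw [pow_dvd_iff_le_emultiplicity,
      emultiplicity_eq_count_normalizedFactors h2 h0, h1.normalize_eq_self]
    norm_cast
  calc
    _ = ∑ k ∈ Finset.Icc 1 n, ∑ P ∈ (normalizedFactors f).toFinset.filter
          (fun P => P.natDegree ∣ k ∧ k / P.natDegree ≤ (normalizedFactors f).count P),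
          P.natDegree := by
      refine Finset.sum_congr rfl fun k hk => Finset.sum_congr ?_ fun _ _ => rfl
      have hk0 : k ≠ 0 := by have := (Finset.mem_Icc.1 hk).1; omega
      ext P
      rw [Finset.mem_filter, Finset.mem_filter, mem_primeFinset hk0]
      constructor
      · rintro ⟨⟨h1, h2, h3⟩, h4⟩
        have h5 : P ∈ (normalizedFactors f).toFinset := by
          rw [Multiset.mem_toFinset, hmem]
          refine ⟨h1, h2, (dvd_pow_self P ?_).trans h4⟩
          exact (Nat.div_pos (Nat.le_of_dvd (Nat.pos_of_ne_zero hk0) h3) h2.natDegree_pos).ne'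
        exact ⟨h5, h3, (hcount P h5 _).1 h4⟩
      · rintro ⟨h5, h3, h4⟩
        obtain ⟨h1, h2, -⟩ := (hmem P).1 (Multiset.mem_toFinset.1 h5)
        exact ⟨⟨h1, h2, h3⟩, (hcount P h5 _).2 h4⟩
    _ = ∑ P ∈ (normalizedFactors f).toFinset, (normalizedFactors f).count P * P.natDegree := by
      simp_rw [Finset.sum_filter]
      rw [Finset.sum_comm]
      refine Finset.sum_congr rfl fun P hP => ?_
      rw [← Finset.sum_filter, Finset.sum_const, smul_eq_mul, card_filter_dvd_div_le]
      · exact ((hmem P).1 (Multiset.mem_toFinset.1 hP)).2.1.natDegree_pos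
      · rw [← hsum]
        exact Finset.single_le_sum
          (f := fun P => (normalizedFactors f).count P * P.natDegree) (fun _ _ => zero_le) hP
    _ = n := hsum

/-- The sum of `Ψ` over monic polynomials of degree `n`. -/
noncomputable def monicSum (Ψ : F[X] →* ℂ) (n : ℕ) : ℂ := ∑ f ∈ monicFinset F n, Ψ f

/-- The sum of `Ψ` over prime powers of degree `k`, weighted by the degree of the prime. -/
noncomputable def primeSum (Ψ : F[X] →* ℂ) (k : ℕ) : ℂ :=
  ∑ P ∈ primeFinset F k, (P.natDegree : ℂ) * Ψ P ^ (k / P.natDegree)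

open Classical in
theorem sum_monicFinset_filter_dvd (Ψ : F[X] →* ℂ) {n k : ℕ} (hkn : k ≤ n) {Q : F[X]}
    (hQ : Q ∈ monicFinset F k) :
    ∑ f ∈ (monicFinset F n).filter (Q ∣ ·), Ψ f = Ψ Q * monicSum Ψ (n - k) := by
  obtain ⟨hm, hd⟩ := mem_monicFinset.1 hQ
  rw [monicSum, Finset.mul_sum]
  symm
  refine Finset.sum_bij (fun h _ => Q * h) ?_ ?_ ?_ ?_
  · intro h hh
    obtain ⟨h1, h2⟩ := mem_monicFinset.1 hh
    rw [Finset.mem_filter, mem_monicFinset]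
    exact ⟨⟨hm.mul h1, by rw [hm.natDegree_mul h1]; omega⟩, dvd_mul_right _ _⟩
  · intro a _ b _ hab
    exact mul_left_cancel₀ hm.ne_zero hab
  · intro f hf
    rw [Finset.mem_filter, mem_monicFinset] at hf
    obtain ⟨⟨h1, h2⟩, h, rfl⟩ := hf
    have h3 : h.Monic := hm.of_mul_monic_left h1
    rw [hm.natDegree_mul h3] at h2
    exact ⟨h, mem_monicFinset.2 ⟨h3, by omega⟩, rfl⟩
  · intro h _
    rw [map_mul]

/-- Logarithmic derivative of the Euler product of `∑ Ψ(f) T ^ deg f`. -/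
theorem natCast_mul_monicSum (Ψ : F[X] →* ℂ) (n : ℕ) :
    (n : ℂ) * monicSum Ψ n = ∑ k ∈ Finset.Icc 1 n, primeSum Ψ k * monicSum Ψ (n - k) := by
  classical
  calc
    _ = ∑ f ∈ monicFinset F n, ∑ k ∈ Finset.Icc 1 n, ∑ P ∈ primeFinset F k,
          if P ^ (k / P.natDegree) ∣ f then (P.natDegree : ℂ) * Ψ f else 0 := by
      rw [monicSum, Finset.mul_sum]
      refine Finset.sum_congr rfl fun f hf => ?_
      nth_rw 1 [← sum_natDegree_primeFinset_pow_dvd hf]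
      simp_rw [← Finset.sum_filter]
      push_cast
      simp_rw [Finset.sum_mul]
    _ = _ := by
      rw [Finset.sum_comm]
      refine Finset.sum_congr rfl fun k hk => ?_
      rw [Finset.mem_Icc] at hk
      rw [Finset.sum_comm, primeSum, Finset.sum_mul]
      refine Finset.sum_congr rfl fun P hP => ?_
      obtain ⟨h1, h2, h3⟩ := (mem_primeFinset (by omega)).1 hP
      have h4 : P ^ (k / P.natDegree) ∈ monicFinset F k :=
        mem_monicFinset.2 ⟨h1.pow _, by rw [natDegree_pow, Nat.div_mul_cancel h3]⟩
      rw [← Finset.sum_filter, ← Finset.mul_sum, sum_monicFinset_filter_dvd Ψ hk.2 h4, map_pow,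
        mul_assoc]

theorem monicSum_zero (Ψ : F[X] →* ℂ) : monicSum Ψ 0 = 1 := by
  have : monicFinset F 0 = {1} := by
    ext f
    rw [mem_monicFinset, Finset.mem_singleton]
    constructor
    · rintro ⟨h1, h2⟩
      exact h1.natDegree_eq_zero.1 h2
    · rintro rfl
      exact ⟨monic_one, natDegree_one⟩
  rw [monicSum, this, Finset.sum_singleton, map_one]

end MonicPolynomials

section Extension

open Polynomial Module

variable {F : Type*} [Field F] {E : Type*} [Field E] [Fintype E] [Algebra F E]

open IntermediateField in
theorem eval_minpoly_pow (x : E) (a : F) :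
    eval a (minpoly F x ^ (finrank F E / (minpoly F x).natDegree)) =
      Algebra.norm F (algebraMap F E a - x) := by
  have hx : IsIntegral F x := .of_finite F x
  have h1 : Algebra.norm F (algebraMap F E a - x) =
      Algebra.norm F (algebraMap F F⟮x⟯ a - AdjoinSimple.gen F x) ^ finrank F⟮x⟯ E := by
    have h : algebraMap F E a - x =
        algebraMap F⟮x⟯ E (algebraMap F F⟮x⟯ a - AdjoinSimple.gen F x) := by
      rw [map_sub, ← IsScalarTower.algebraMap_apply, AdjoinSimple.algebraMap_gen]
    rw [h, ← Algebra.norm_norm (S := F⟮x⟯), Algebra.norm_algebraMap, map_pow]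
  have h2 : Algebra.norm F (algebraMap F F⟮x⟯ a - AdjoinSimple.gen F x) =
      eval a (minpoly F x) := by
    have h3 := charpoly_leftMulMatrix (adjoin.powerBasis hx)
    rw [adjoin.powerBasis_gen, minpoly_gen] at h3
    rw [← h3, Matrix.eval_charpoly, Algebra.norm_eq_matrix_det (adjoin.powerBasis hx).basis,
      map_sub, AlgHom.commutes]
    rfl
  have h4 : finrank F E / (minpoly F x).natDegree = finrank F⟮x⟯ E := by
    rw [← finrank_mul_finrank F F⟮x⟯ E, adjoin.finrank hx,
      Nat.mul_div_cancel_left _ (minpoly.natDegree_pos hx)]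
  rw [h1, h2, h4, eval_pow]

variable [Fintype F]

theorem card_filter_minpoly_eq [DecidableEq F[X]] {P : F[X]}
    (hP : P ∈ primeFinset F (finrank F E)) :
    (Finset.univ.filter fun x : E => minpoly F x = P).card = P.natDegree := by
  classical
  have hn : finrank F E ≠ 0 := finrank_pos.ne'
  obtain ⟨hm, hi, hd⟩ := (mem_primeFinset hn).1 hP
  have h1 : (P.map (algebraMap F E)).Splits := by
    have h2 := hi.natDegree_dvd_iff_dvd_X_pow_card_pow_sub_X.1 hd
    rw [← Module.natCard_eq_pow_finrank, Nat.card_eq_fintype_card] at h2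
    refine ((FiniteField.isSplittingField_sub E F).splits).of_dvd ?_ (map_dvd (algebraMap F E) h2)
    exact (Polynomial.map_ne_zero
      (FiniteField.X_pow_card_sub_X_ne_zero F Fintype.one_lt_card))
  have h2 : P.Separable := PerfectField.separable_of_irreducible hi
  have h3 : (P.aroots E).Nodup := nodup_aroots_iff_of_splits hm.ne_zero h1 |>.2 h2
  have h4 : (Finset.univ.filter fun x : E => minpoly F x = P) = (P.aroots E).toFinset := by
    ext x
    simp only [Finset.mem_filter, Finset.mem_univ, true_and, Multiset.mem_toFinset,
      mem_aroots, ne_eq, hm.ne_zero, not_false_eq_true]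
    constructor
    · rintro rfl
      exact minpoly.aeval _ _
    · intro h
      exact (minpoly.eq_of_irreducible_of_monic hi h hm).symm
  rw [h4, Multiset.toFinset_card_of_nodup h3, aroots_def, ← h1.natDegree_eq_card_roots,
    natDegree_map]

theorem primeSum_finrank (Ψ : F[X] →* ℂ) :
    primeSum Ψ (finrank F E) =
      ∑ x : E, Ψ (minpoly F x ^ (finrank F E / (minpoly F x).natDegree)) := by
  classical
  have hn : finrank F E ≠ 0 := finrank_pos.ne'
  rw [primeSum, ← Finset.sum_fiberwise_of_maps_to (s := Finset.univ)
    (t := primeFinset F (finrank F E)) (g := fun x : E => minpoly F x)]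
  · refine Finset.sum_congr rfl fun P hP => ?_
    rw [← card_filter_minpoly_eq hP, ← nsmul_eq_mul, ← Finset.sum_const]
    refine Finset.sum_congr rfl fun x hx => ?_
    rw [(Finset.mem_filter.1 hx).2, map_pow, card_filter_minpoly_eq hP]
  · intro x _
    have hx : IsIntegral F x := .of_finite F x
    exact (mem_primeFinset hn).2 ⟨minpoly.monic hx, minpoly.irreducible hx, minpoly.degree_dvd hx⟩

end Extension

section EvaluationCharacters

open Polynomial

variable {F : Type*} [Field F] {ι : Type*} [Fintype ι]

/-- The multiplicative function `f ↦ ∏ ψᵢ(f(xᵢ))` on polynomials. -/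
noncomputable def evalHom (x : ι → F) (ψ : ι → MulChar F ℂ) : F[X] →* ℂ where
  toFun f := ∏ i, ψ i (f.eval (x i))
  map_one' := by simp
  map_mul' f g := by simp [Finset.prod_mul_distrib]

theorem evalHom_apply (x : ι → F) (ψ : ι → MulChar F ℂ) (f : F[X]) :
    evalHom x ψ f = ∏ i, ψ i (f.eval (x i)) := rfl

variable [Fintype F]

theorem primeSum_evalHom (E : Type*) [Field E] [Fintype E] [Algebra F E] (x : ι → F)
    (ψ : ι → MulChar F ℂ) :
    primeSum (evalHom x ψ) (Module.finrank F E) =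
      ∑ y : E, ∏ i, ψ i (Algebra.norm F (algebraMap F E (x i) - y)) := by
  rw [primeSum_finrank]
  simp_rw [evalHom_apply, eval_minpoly_pow]

theorem monicSum_evalHom_eq_zero {x : ι → F} {ψ : ι → MulChar F ℂ} {i : ι} (hψ : ψ i ≠ 1)
    {w : F[X]} (hwi : w.eval (x i) = 1) (hw : ∀ j ≠ i, w.eval (x j) = 0) {n : ℕ}
    (hn : w.natDegree < n) : monicSum (evalHom x ψ) n = 0 := by
  classical
  have shift : ∀ t : F, ∑ f ∈ monicFinset F n, evalHom x ψ (f + C t * w) =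
      monicSum (evalHom x ψ) n := by
    have key : ∀ (t : F), ∀ f ∈ monicFinset F n, f + C t * w ∈ monicFinset F n := by
      intro t f hf
      obtain ⟨h1, h2⟩ := mem_monicFinset.1 hf
      have hlt : (C t * w).natDegree < f.natDegree := by
        rw [h2]
        exact (natDegree_C_mul_le t w).trans_lt hn
      exact mem_monicFinset.2 ⟨h1.add_of_left (degree_lt_degree hlt),
        (natDegree_add_eq_left_of_natDegree_lt hlt).trans h2⟩
    intro t
    refine Finset.sum_bij' (fun f _ => f + C t * w) (fun f _ => f + C (-t) * w) (key t) (key (-t))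
      ?_ ?_ ?_
    · intro f _
      simp
    · intro f _
      simp
    · intro f _
      rfl
  have hcalc : (Fintype.card F : ℂ) * monicSum (evalHom x ψ) n = 0 := by
    rw [← nsmul_eq_mul, ← Finset.card_univ, ← Finset.sum_const,
      Finset.sum_congr rfl fun t _ => (shift t).symm, Finset.sum_comm]
    refine Finset.sum_eq_zero fun f _ => ?_
    have hterm : ∀ t : F, evalHom x ψ (f + C t * w) =
        ψ i (f.eval (x i) + t) * ∏ j ∈ Finset.univ.erase i, ψ j (f.eval (x j)) := by
      intro t
      rw [evalHom_apply, ← Finset.mul_prod_erase _ _ (Finset.mem_univ i)]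
      congr 1
      · simp [hwi]
      · refine Finset.prod_congr rfl fun j hj => ?_
        simp [hw j (Finset.ne_of_mem_erase hj)]
    simp_rw [hterm]
    have hs : ∑ t, ψ i (f.eval (x i) + t) = ∑ t, ψ i t :=
      Equiv.sum_comp (Equiv.addLeft (f.eval (x i))) fun t => ψ i t
    rw [← Finset.sum_mul, hs, MulChar.sum_eq_zero_of_ne_one hψ, zero_mul]
  exact (mul_eq_zero.1 hcalc).resolve_left (Nat.cast_ne_zero.2 Fintype.card_ne_zero)

theorem primeSum_eq_of_monicSum_eq_zero {Ψ : F[X] →* ℂ} (hΨ : ∀ n ≥ 2, monicSum Ψ n = 0) (k : ℕ) :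
    primeSum Ψ (k + 1) = -(-monicSum Ψ 1) ^ (k + 1) := by
  induction k with
  | zero =>
    have h := natCast_mul_monicSum Ψ 1
    simp [monicSum_zero] at h
    simp [h]
  | succ k ih =>
    have h := natCast_mul_monicSum Ψ (k + 2)
    rw [hΨ _ (by omega), Finset.sum_Icc_succ_top (by omega), Finset.sum_Icc_succ_top (by omega),
      Finset.sum_eq_zero, ih] at h
    · have h1 : k + 2 - (k + 1) = 1 := by omega
      simp only [h1, Nat.sub_self, monicSum_zero, add_assoc, Nat.reduceAdd] at h
      rw [add_assoc]
      linear_combination -h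
    · intro j hj
      have := Finset.mem_Icc.1 hj
      rw [hΨ _ (by omega), mul_zero]

theorem monicSum_one_evalHom (x : ι → F) (ψ : ι → MulChar F ℂ) :
    monicSum (evalHom x ψ) 1 = ∑ a : F, ∏ i, ψ i (x i - a) := by
  classical
  symm
  refine Finset.sum_bij (fun a _ => X - C a) ?_ ?_ ?_ ?_
  · intro a _
    exact mem_monicFinset.2 ⟨monic_X_sub_C a, natDegree_X_sub_C a⟩
  · intro a _ b _ h
    simpa using h
  · intro f hf
    obtain ⟨h1, h2⟩ := mem_monicFinset.1 hf
    refine ⟨-f.coeff 0, Finset.mem_univ _, ?_⟩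
    rw [h1.eq_X_add_C h2]
    simp
  · intro a _
    simp [evalHom_apply]

/-- Newton's identities in degree four for the coefficients of the generating series of `Ψ`. -/
theorem monicSum_four_of_primeSum {Ψ : F[X] →* ℂ} {a b c d : ℂ}
    (h : ∀ k ∈ Finset.Icc 1 4, primeSum Ψ k = -((-a) ^ k + (-b) ^ k + (-c) ^ k + (-d) ^ k)) :
    monicSum Ψ 4 = a * b * c * d := by
  have e1 := h 1 (by decide)
  have e2 := h 2 (by decide)
  have e3 := h 3 (by decide)
  have e4 := h 4 (by decide)
  have n1 := natCast_mul_monicSum Ψ 1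
  have n2 := natCast_mul_monicSum Ψ 2
  have n3 := natCast_mul_monicSum Ψ 3
  have n4 := natCast_mul_monicSum Ψ 4
  simp [Finset.sum_Icc_succ_top, monicSum_zero, e1, e2, e3, e4] at n1 n2 n3 n4
  have m2 : monicSum Ψ 2 = a * b + a * c + a * d + b * c + b * d + c * d := by
    rw [n1] at n2
    linear_combination n2 / 2
  have m3 : monicSum Ψ 3 = a * b * c + a * b * d + a * c * d + b * c * d := by
    rw [m2, n1] at n3
    linear_combination n3 / 3
  rw [m3, m2, n1] at n4
  linear_combination n4 / 4

end EvaluationCharacters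

section FifthPowers

open Polynomial

variable {E : Type*} [Field E]

theorem orderOf_apply_generator (X : MulChar E ℂ) {g : Eˣ} (hg : ∀ x, x ∈ Subgroup.zpowers g) :
    orderOf (X g) = orderOf X := by
  refine orderOf_eq_orderOf_iff.2 fun n => ?_
  rw [MulChar.eq_iff hg, MulChar.pow_apply_coe, MulChar.one_apply_coe]

variable [Fintype E]

theorem exists_isPrimitiveRoot_orderOf (X : MulChar E ℂ) :
    ∃ ζ : E, IsPrimitiveRoot ζ (orderOf X) := by
  classical
  obtain ⟨g, hg⟩ := IsCyclic.exists_ofOrder_eq_natCard (α := Eˣ)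
  have hcard : orderOf g = Fintype.card E - 1 := by
    rw [hg, Nat.card_eq_fintype_card, Fintype.card_units]
  obtain ⟨m, hm⟩ := hcard ▸ X.orderOf_dvd_card_sub_one
  have h0 : 0 < orderOf g := orderOf_pos g
  exact ⟨_, IsPrimitiveRoot.coe_units_iff.2
    ((IsPrimitiveRoot.orderOf g).pow h0 (hm.trans (mul_comm _ _)))⟩

theorem exists_pow_five_eq_of_mulChar {X : MulChar E ℂ} (hX : orderOf X = 5) {a : E}
    (ha : a ≠ 0) (h : X a = 1) : ∃ b, b ^ 5 = a := by
  obtain ⟨g, hg⟩ := IsCyclic.exists_generator (α := Eˣ)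
  obtain ⟨m, hm⟩ := Subgroup.mem_zpowers_iff.1 (hg (Units.mk0 a ha))
  have hu : orderOf (X.toUnitHom g) = 5 := by
    rw [← hX, ← orderOf_units, MulChar.coe_toUnitHom, orderOf_apply_generator X hg]
  have hz : X.toUnitHom g ^ m = 1 := by
    rw [← map_zpow, hm]
    ext
    rw [MulChar.coe_toUnitHom]
    exact h
  obtain ⟨k, rfl⟩ := orderOf_dvd_iff_zpow_eq_one.2 hz
  refine ⟨((g ^ k : Eˣ) : E), ?_⟩
  rw [← Units.val_pow_eq_pow_val, ← zpow_natCast, ← zpow_mul, mul_comm k, ← Units.val_mk0 ha,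
    ← hm, hu]

theorem sum_pow_mulChar_eq_card [DecidableEq E] {X : MulChar E ℂ} (hX : orderOf X = 5) {a : E}
    (ha : a ≠ 0) :
    ∑ i ∈ Finset.range 5, (X ^ i) a = ((Finset.univ.filter fun b : E => b ^ 5 = a).card : ℂ) := by
  have h5 : X ^ 5 = 1 := hX ▸ pow_orderOf_eq_one X
  have hpow : ∀ i, (X ^ i) a = X a ^ i := fun i => MulChar.pow_apply_coe X i (Units.mk0 a ha)
  have hXa5 : X a ^ 5 = 1 := by
    rw [← hpow, h5, MulChar.one_apply ha.isUnit]
  simp_rw [hpow]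
  by_cases h : X a = 1
  · obtain ⟨ζ, hζ⟩ := exists_isPrimitiveRoot_orderOf X
    rw [hX] at hζ
    have hc := hζ.card_nthRoots a
    rw [if_pos (exists_pow_five_eq_of_mulChar hX ha h)] at hc
    have hf : (Finset.univ.filter fun b : E => b ^ 5 = a) = (nthRoots 5 a).toFinset := by
      ext b
      simp [mem_nthRoots]
    rw [hf, Multiset.toFinset_card_of_nodup (hζ.nthRoots_nodup ha), hc, h]
    norm_num
  · rw [Finset.card_eq_zero.2, geom_sum_eq h, hXa5]
    · simp
    · refine Finset.filter_eq_empty_iff.2 fun b _ hb => h ?_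
      have hb0 : b ≠ 0 := by
        rintro rfl
        exact ha (by rw [← hb]; simp)
      rw [← hb, map_pow, ← MulChar.pow_apply' _ (by norm_num), h5, MulChar.one_apply hb0.isUnit]

theorem sum_comp_pow_five {X : MulChar E ℂ} (hX : orderOf X = 5) (f : E → ℂ) :
    ∑ b, f (b ^ 5) = f 0 + ∑ i ∈ Finset.range 5, ∑ a, (X ^ i) a * f a := by
  classical
  rw [Finset.sum_comm, ← Finset.sum_fiberwise_of_maps_to (s := Finset.univ) (t := Finset.univ)
    (g := fun b : E => b ^ 5) (fun _ _ => Finset.mem_univ _),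
    ← Finset.add_sum_erase _ _ (Finset.mem_univ (0 : E)),
    ← Finset.add_sum_erase _ (fun a => ∑ i ∈ Finset.range 5, (X ^ i) a * f a)
      (Finset.mem_univ (0 : E)), ← add_assoc]
  congr 1
  · have h0 : (Finset.univ.filter fun b : E => b ^ 5 = 0) = {0} := by
      ext b
      simp
    rw [h0]
    simp [MulChar.map_zero]
  · refine Finset.sum_congr rfl fun a ha => ?_
    rw [← Finset.sum_mul, sum_pow_mulChar_eq_card hX (Finset.ne_of_mem_erase ha), ← nsmul_eq_mul,
      ← Finset.sum_const]
    refine Finset.sum_congr rfl fun b hb => ?_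
    rw [(Finset.mem_filter.1 hb).2]

end FifthPowers

section NormCharacter

variable {F : Type*} [Field F] (E : Type*) [Field E] [Fintype E] [Algebra F E]

/-- The composition of a multiplicative character with the norm of a field extension. -/
noncomputable def normChar : MulChar F ℂ →* MulChar E ℂ where
  toFun χ := MulChar.ofUnitHom (χ.toUnitHom.comp (Units.map (Algebra.norm F)))
  map_one' := by
    ext a
    rw [MulChar.ofUnitHom_coe, MulChar.one_apply_coe]
    exact (congrArg _ (Units.coe_map _ a).symm).trans (MulChar.one_apply_coe _)
  map_mul' χ χ' := by
    ext a
    simp [MulChar.mul_apply]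

theorem normChar_apply (χ : MulChar F ℂ) (a : E) : normChar E χ a = χ (Algebra.norm F a) := by
  by_cases ha : a = 0
  · rw [ha, Algebra.norm_zero, MulChar.map_zero, MulChar.map_zero]
  · exact MulChar.ofUnitHom_coe _ (Units.mk0 a ha)

theorem normChar_injective [Finite F] : Function.Injective (normChar (F := F) E) := by
  intro χ χ' h
  ext a
  obtain ⟨b, hb⟩ := FiniteField.norm_surjective F E a
  rw [← hb, ← normChar_apply, h, normChar_apply]

end NormCharacter

section JacobiSums

open Polynomial

variable {F : Type*} [Field F]

theorem prod_primitiveRoot_pow_sub {ζ : F} (hζ : IsPrimitiveRoot ζ 5) (b : F) :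
    ∏ j : Fin 5, (ζ ^ (j : ℕ) - b) = 1 - b ^ 5 := by
  have h := hζ.geom_sum_eq_zero (by norm_num)
  simp only [Finset.sum_range_succ, Finset.sum_range_zero] at h
  simp only [Fin.prod_univ_five]
  simp
  linear_combination (b ^ 4 - b ^ 3 * (ζ + ζ ^ 3) + b ^ 2 * (ζ ^ 3 + ζ ^ 5) - b * ζ ^ 6 +
    (ζ - 1) * (ζ ^ 5 + 1)) * h

variable [Fintype F]

theorem primeSum_evalHom_jacobi {χ θ : MulChar F ℂ} (hχ : χ (-1) = 1) (hθ : θ ≠ 1) {k : ℕ}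
    (hk : k ≠ 0) : primeSum (evalHom ![0, 1] ![χ, θ]) k = -(-jacobiSum χ θ) ^ k := by
  obtain ⟨k, rfl⟩ := Nat.exists_eq_succ_of_ne_zero hk
  have h1 : monicSum (evalHom ![0, 1] ![χ, θ]) 1 = jacobiSum χ θ := by
    rw [monicSum_one_evalHom, jacobiSum]
    refine Finset.sum_congr rfl fun a _ => ?_
    have ha : χ (-a) = χ a := by rw [← neg_one_mul, map_mul, hχ, one_mul]
    simp [ha]
  refine (primeSum_eq_of_monicSum_eq_zero (fun n hn => ?_) k).trans (by rw [h1])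
  refine monicSum_evalHom_eq_zero (i := 1) (w := X) (by simpa using hθ) (by simp) ?_
    (natDegree_X_le.trans_lt (by omega))
  intro j hj
  fin_cases j
  · simp
  · simp at hj

theorem primeSum_evalHom_rootsOfUnity_finrank (E : Type*) [Field E] [Fintype E] [Algebra F E]
    {χ : MulChar F ℂ} (hχ : orderOf χ = 5) (θ : MulChar F ℂ) {ζ : F} (hζ : IsPrimitiveRoot ζ 5) :
    primeSum (evalHom (fun j : Fin 5 => ζ ^ (j : ℕ)) fun _ => θ) (Module.finrank F E) =
      1 + ∑ i ∈ Finset.range 5,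
        primeSum (evalHom ![0, 1] ![χ ^ i, θ]) (Module.finrank F E) := by
  have hζE : IsPrimitiveRoot (algebraMap F E ζ) 5 := hζ.map_of_injective (algebraMap F E).injective
  have hX : orderOf (normChar E χ) = 5 := by
    rw [orderOf_injective _ (normChar_injective E), hχ]
  have hneg : ∀ i, (χ ^ i) (-1) = 1 := fun i =>
    MulChar.val_neg_one_eq_one_of_odd_order (n := 5) (by decide)
      (by rw [← pow_mul, mul_comm, pow_mul, ← hχ, pow_orderOf_eq_one, one_pow])
  simp_rw [primeSum_evalHom]
  have h1 : ∀ y : E, ∏ j : Fin 5, θ (Algebra.norm F (algebraMap F E (ζ ^ (j : ℕ)) - y)) =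
      θ (Algebra.norm F (1 - y ^ 5)) := by
    intro y
    rw [← prod_primitiveRoot_pow_sub hζE, map_prod, map_prod]
    simp_rw [map_pow]
  simp_rw [h1]
  rw [sum_comp_pow_five hX (fun a => θ (Algebra.norm F (1 - a)))]
  congr 1
  · simp
  · refine Finset.sum_congr rfl fun i _ => Finset.sum_congr rfl fun a _ => ?_
    rw [← map_pow, normChar_apply]
    have hn : (χ ^ i) (Algebra.norm F (-a)) = (χ ^ i) (Algebra.norm F a) := by
      rw [← neg_one_mul, map_mul, map_mul]
      have : Algebra.norm F (-1 : E) = (-1) ^ (Module.finrank F E) := by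
        have := Algebra.norm_algebraMap (S := E) (-1 : F)
        simpa using this
      rw [this, map_pow, hneg, one_pow, one_mul]
    simp [hn]

theorem monicSum_evalHom_rootsOfUnity {χ θ : MulChar F ℂ} (hχ : orderOf χ = 5) (hθ : θ ≠ 1) {ζ : F}
    (hζ : IsPrimitiveRoot ζ 5) :
    monicSum (evalHom (fun j : Fin 5 => ζ ^ (j : ℕ)) fun _ => θ) 4 =
      jacobiSum χ θ * jacobiSum (χ ^ 2) θ * jacobiSum (χ ^ 3) θ * jacobiSum (χ ^ 4) θ := by
  have hneg : ∀ i, (χ ^ i) (-1) = 1 := fun i =>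
    MulChar.val_neg_one_eq_one_of_odd_order (n := 5) (by decide)
      (by rw [← pow_mul, mul_comm, pow_mul, ← hχ, pow_orderOf_eq_one, one_pow])
  refine monicSum_four_of_primeSum fun k hk => ?_
  have hk0 : k ≠ 0 := by
    have := Finset.mem_Icc.1 hk
    omega
  have : NeZero k := ⟨hk0⟩
  obtain ⟨p, hp⟩ := CharP.exists F
  have : Fact p.Prime := ⟨CharP.char_is_prime F p⟩
  have : Fintype (FiniteField.Extension F p k) := Fintype.ofFinite _
  have h := primeSum_evalHom_rootsOfUnity_finrank (FiniteField.Extension F p k) hχ θ hζ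
  rw [FiniteField.finrank_extension] at h
  rw [h, Finset.sum_congr rfl fun i _ => primeSum_evalHom_jacobi (hneg i) hθ hk0]
  simp [Finset.sum_range_succ, jacobiSum_one_nontrivial hθ]
  ring

end JacobiSums

section FiveNodeGaussSum

open Polynomial

variable {F : Type*} [Field F]

theorem sum_primitiveRoot_vandermonde {ζ : F} (hζ : IsPrimitiveRoot ζ 5) (c : Fin 5 → F) :
    ∑ j : Fin 5, ζ ^ (j : ℕ) * (Matrix.vandermonde fun j : Fin 5 => ζ ^ (j : ℕ)).mulVec c j =
      5 * c 4 := by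
  have h5 := hζ.pow_eq_one
  have h : ∀ k, Nat.Coprime k 5 → ∑ i ∈ Finset.range 5, (ζ ^ k) ^ i = 0 := fun k hk =>
    (hζ.pow_of_coprime k hk).geom_sum_eq_zero (by norm_num)
  have h1 := h 1 (by norm_num)
  have h2 := h 2 (by norm_num)
  have h3 := h 3 (by norm_num)
  have h4 := h 4 (by norm_num)
  simp only [Finset.sum_range_succ, Finset.sum_range_zero] at h1 h2 h3 h4
  simp [Matrix.mulVec, dotProduct, Matrix.vandermonde_apply, Fin.sum_univ_five]
  linear_combination c 0 * h1 + c 1 * h2 + c 2 * h3 + c 3 * h4 +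
    c 4 * (ζ ^ 15 + 2 * ζ ^ 10 + 3 * ζ ^ 5 + 4) * h5

variable [Fintype F]

theorem monicSum_evalHom_eq_sum_coeff (x : Fin 5 → F) (θ : MulChar F ℂ) [DecidableEq F] :
    monicSum (evalHom x fun _ => θ) 4 =
      ∑ c : Fin 5 → F with c 4 = 1, ∏ j, θ ((Matrix.vandermonde x).mulVec c j) := by
  refine Finset.sum_bij (fun f _ i => f.coeff i) ?_ ?_ ?_ ?_
  · intro f hf
    obtain ⟨h1, h2⟩ := mem_monicFinset.1 hf
    rw [Finset.mem_filter]
    refine ⟨Finset.mem_univ _, ?_⟩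
    have := h1.coeff_natDegree
    rwa [h2] at this
  · intro f hf g hg h
    obtain ⟨h1, h2⟩ := mem_monicFinset.1 hf
    obtain ⟨h3, h4⟩ := mem_monicFinset.1 hg
    ext n
    by_cases hn : n < 5
    · exact congrFun h ⟨n, hn⟩
    · rw [coeff_eq_zero_of_natDegree_lt (by omega), coeff_eq_zero_of_natDegree_lt (by omega)]
  · intro c hc
    have hcoeff : ∀ i : Fin 5, (∑ k : Fin 5, C (c k) * X ^ (k : ℕ)).coeff i = c i := by
      intro i
      simp [coeff_X_pow, Fin.val_inj]
    have hdeg : (∑ k : Fin 5, C (c k) * X ^ (k : ℕ)).natDegree ≤ 4 :=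
      natDegree_le_of_degree_le (Order.le_of_lt_succ (degree_sum_fin_lt c))
    have h4 : (∑ k : Fin 5, C (c k) * X ^ (k : ℕ)).coeff 4 = 1 :=
      (hcoeff 4).trans (Finset.mem_filter.1 hc).2
    refine ⟨_, mem_monicFinset.2 ⟨monic_of_natDegree_le_of_coeff_eq_one 4 hdeg h4, ?_⟩,
      funext hcoeff⟩
    exact natDegree_eq_of_le_of_coeff_ne_zero hdeg (by rw [h4]; exact one_ne_zero)
  · intro f hf
    obtain ⟨h1, h2⟩ := mem_monicFinset.1 hf
    rw [evalHom_apply]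
    refine Finset.prod_congr rfl fun j _ => ?_
    rw [eval_eq_sum_range' (n := 5) (by omega), Finset.sum_range]
    simp [Matrix.mulVec, dotProduct, Matrix.vandermonde_apply, mul_comm]

theorem sum_filter_prod_vandermonde (x : Fin 5 → F) {θ : MulChar F ℂ} (hθ : θ ^ 5 ≠ 1)
    [DecidableEq F] (t : F) :
    ∑ c : Fin 5 → F with c 4 = t, ∏ j, θ ((Matrix.vandermonde x).mulVec c j) =
      (θ ^ 5) t * ∑ c : Fin 5 → F with c 4 = 1, ∏ j, θ ((Matrix.vandermonde x).mulVec c j) := by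
  have scale : ∀ (u : Fˣ) (s : F),
      ∑ c : Fin 5 → F with c 4 = u * s, ∏ j, θ ((Matrix.vandermonde x).mulVec c j) =
        (θ ^ 5) u * ∑ c : Fin 5 → F with c 4 = s, ∏ j, θ ((Matrix.vandermonde x).mulVec c j) := by
    intro u s
    rw [Finset.mul_sum]
    symm
    refine Finset.sum_bij' (fun c _ => u • c) (fun c _ => u⁻¹ • c) ?_ ?_ ?_ ?_ ?_
    · intro c hc
      simpa [Units.smul_def] using hc
    · intro c hc
      have := (Finset.mem_filter.1 hc).2
      simp [Units.smul_def, this]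
    · intro c _
      simp
    · intro c _
      simp
    · intro c _
      rw [Units.smul_def, Matrix.mulVec_smul, MulChar.pow_apply_coe]
      simp [Finset.prod_mul_distrib]
  by_cases ht : t = 0
  · obtain ⟨u, hu⟩ := MulChar.ne_one_iff.1 hθ
    have h := scale u 0
    rw [mul_zero] at h
    subst ht
    rw [MulChar.map_zero, zero_mul]
    by_contra hne
    exact hu (mul_right_cancel₀ hne (by rw [← h, one_mul]))
  · have h := scale (Units.mk0 t ht) 1
    simpa using h

theorem gaussSum_pow_five_eq {φ : AddChar F ℂ} {θ : MulChar F ℂ} (hθ : θ ^ 5 ≠ 1)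
    (h5 : (5 : F) ≠ 0) {ζ : F} (hζ : IsPrimitiveRoot ζ 5) :
    θ 5 ^ 5 * gaussSum θ φ ^ 5 =
      gaussSum (θ ^ 5) φ * monicSum (evalHom (fun j : Fin 5 => ζ ^ (j : ℕ)) fun _ => θ) 4 := by
  classical
  have hζ0 : ζ ≠ 0 := hζ.ne_zero (by norm_num)
  have hu : ∀ j : Fin 5, ζ ^ (j : ℕ) / 5 ≠ 0 := fun j => div_ne_zero (pow_ne_zero _ hζ0) h5
  have hleft : ∏ j : Fin 5, ∑ y : F, θ y * φ (ζ ^ (j : ℕ) / 5 * y) =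
      θ 5 ^ 5 * gaussSum θ φ ^ 5 := by
    have h1 : ∀ j : Fin 5, ∑ y : F, θ y * φ (ζ ^ (j : ℕ) / 5 * y) =
        θ⁻¹ (ζ ^ (j : ℕ) / 5) * gaussSum θ φ := fun j =>
      gaussSum_mulShift_eq θ φ (Units.mk0 _ (hu j))
    have h2 : ∏ j : Fin 5, (ζ ^ (j : ℕ) / 5)⁻¹ = 5 ^ 5 := by
      have h10 : ζ ^ 10 = 1 := by rw [show 10 = 5 * 2 from rfl, pow_mul, hζ.pow_eq_one, one_pow]
      simp only [inv_div, Finset.prod_div_distrib, Finset.prod_const, Fin.prod_univ_five]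
      simp [← pow_succ', ← pow_add, h10]
    simp_rw [h1, Finset.prod_mul_distrib, MulChar.inv_apply', ← map_prod, h2]
    simp
  have hbij : Function.Bijective
      (Matrix.vandermonde fun j : Fin 5 => ζ ^ (j : ℕ)).mulVec := by
    refine Finite.injective_iff_bijective.1 (Matrix.mulVec_injective_iff_isUnit.2 ?_)
    rw [Matrix.isUnit_iff_isUnit_det, isUnit_iff_ne_zero, Matrix.det_vandermonde_ne_zero_iff]
    intro i j h
    exact Fin.ext (hζ.pow_inj i.2 j.2 h)
  rw [← hleft, Finset.prod_univ_sum, Fintype.piFinset_univ, ← hbij.sum_comp,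
    ← Finset.sum_fiberwise_of_maps_to (s := Finset.univ) (t := Finset.univ)
    (g := fun c : Fin 5 → F => c 4) (fun _ _ => Finset.mem_univ _), gaussSum, Finset.sum_mul]
  refine Finset.sum_congr rfl fun t _ => ?_
  rw [monicSum_evalHom_eq_sum_coeff, mul_right_comm, ← sum_filter_prod_vandermonde _ hθ,
    Finset.sum_mul]
  refine Finset.sum_congr rfl fun c hc => ?_
  rw [Finset.prod_mul_distrib]
  congr 1
  have h3 : ∑ j : Fin 5, ζ ^ (j : ℕ) / 5 *
      (Matrix.vandermonde fun j : Fin 5 => ζ ^ (j : ℕ)).mulVec c j = t := by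
    simp_rw [div_mul_eq_mul_div]
    rw [← Finset.sum_div, sum_primitiveRoot_vandermonde hζ, (Finset.mem_filter.1 hc).2]
    field_simp
  rw [← h3]
  symm
  exact map_sum φ.toAddMonoidHom _ _

end FiveNodeGaussSum

section HasseDavenport

variable {F : Type*} [Field F]

theorem apply_neg_one_of_orderOf_eq_five {χ : MulChar F ℂ} (hχ : orderOf χ = 5) : χ (-1) = 1 :=
  MulChar.val_neg_one_eq_one_of_odd_order (n := 5) (by decide) (hχ ▸ pow_orderOf_eq_one χ)

variable [Fintype F]

theorem exists_pow_eq_of_pow_orderOf_eq_one {χ η : MulChar F ℂ} (hη : η ^ orderOf χ = 1) :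
    ∃ i < orderOf χ, χ ^ i = η := by
  obtain ⟨g, hg⟩ := IsCyclic.exists_generator (α := Fˣ)
  have hζ : IsPrimitiveRoot (χ g) (orderOf χ) :=
    orderOf_apply_generator χ hg ▸ IsPrimitiveRoot.orderOf (χ g)
  have : NeZero (orderOf χ) := ⟨(orderOf_pos χ).ne'⟩
  obtain ⟨i, hi, h⟩ := hζ.eq_pow_of_pow_eq_one (ξ := η g)
    (by rw [← MulChar.pow_apply_coe, hη, MulChar.one_apply_coe])
  exact ⟨i, hi, (MulChar.eq_iff hg _ _).2 (by rw [MulChar.pow_apply_coe, h])⟩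

theorem gaussSum_mul_gaussSum_inv {χ : MulChar F ℂ} (hχ : χ ≠ 1) {φ : AddChar F ℂ} (hφ : φ ≠ 1) :
    gaussSum χ φ * gaussSum χ⁻¹ φ = χ (-1) * Fintype.card F := by
  have h1 := gaussSum_mul_gaussSum_eq_card hχ (AddChar.IsPrimitive.of_ne_one hφ)
  have h2 := mul_gaussSum_inv_eq_gaussSum χ⁻¹ φ
  rw [← h2, ← h1, MulChar.inv_apply', inv_neg_one]
  ring

theorem gaussSum_ne_zero (χ : MulChar F ℂ) {φ : AddChar F ℂ} (hφ : φ ≠ 1) : gaussSum χ φ ≠ 0 := by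
  by_cases hχ : χ = 1
  · rw [hχ, gaussSum_one_left hφ]
    norm_num
  · exact gaussSum_ne_zero_of_nontrivial (Nat.cast_ne_zero.2 Fintype.card_ne_zero) hχ
      (AddChar.IsPrimitive.of_ne_one hφ)

theorem prod_gaussSum_pow {φ : AddChar F ℂ} (hφ : φ ≠ 1) {χ : MulChar F ℂ} (hχ : orderOf χ = 5) :
    gaussSum χ φ * gaussSum (χ ^ 2) φ * gaussSum (χ ^ 3) φ * gaussSum (χ ^ 4) φ =
      (Fintype.card F : ℂ) ^ 2 := by
  have h5 : χ ^ 5 = 1 := hχ ▸ pow_orderOf_eq_one χ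
  have hneg := apply_neg_one_of_orderOf_eq_five hχ
  have h4 : χ ^ 4 = χ⁻¹ := eq_inv_of_mul_eq_one_left (by rw [← pow_succ, h5])
  have h3 : χ ^ 3 = (χ ^ 2)⁻¹ := eq_inv_of_mul_eq_one_left (by rw [← pow_add, h5])
  have n1 : χ ≠ 1 := by
    rintro rfl
    simp at hχ
  have n2 : χ ^ 2 ≠ 1 := pow_ne_one_of_lt_orderOf (by norm_num) (by omega)
  have g1 := gaussSum_mul_gaussSum_inv n1 hφ
  have g2 := gaussSum_mul_gaussSum_inv n2 hφ
  rw [MulChar.pow_apply' _ (by norm_num), hneg, one_pow, one_mul] at g2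
  rw [hneg, one_mul] at g1
  rw [h4, h3]
  linear_combination (gaussSum (χ ^ 2) φ * gaussSum (χ ^ 2)⁻¹ φ) * g1 + (Fintype.card F : ℂ) * g2

/-- The Hasse–Davenport product formula for characters of order five. -/
theorem card_sq_mul_gaussSum_pow_five {φ : AddChar F ℂ} (hφ : φ ≠ 1) {χ : MulChar F ℂ}
    (hχ : orderOf χ = 5) (η : MulChar F ℂ) :
    (Fintype.card F : ℂ) ^ 2 * gaussSum (η ^ 5) φ =
      η 5 ^ 5 * ∏ i ∈ Finset.range 5, gaussSum (χ ^ i * η) φ := by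
  obtain ⟨ζ, hζ⟩ := exists_isPrimitiveRoot_orderOf χ
  rw [hχ] at hζ
  have h5 : χ ^ 5 = 1 := hχ ▸ pow_orderOf_eq_one χ
  have h50 : (5 : F) ≠ 0 := by
    have := hζ.neZero'
    exact_mod_cast this.out
  rw [← prod_gaussSum_pow hφ hχ]
  by_cases hη : η ^ 5 = 1
  · have h1 : η 5 ^ 5 = 1 := by
      rw [← MulChar.pow_apply' _ (by norm_num), hη, MulChar.one_apply h50.isUnit]
    obtain ⟨i, hi, rfl⟩ := exists_pow_eq_of_pow_orderOf_eq_one (χ := χ) (η := η) (by rwa [hχ])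
    rw [hχ] at hi
    have h6 : ∀ k, χ ^ (k + 5) = χ ^ k := fun k => by rw [pow_add, h5, mul_one]
    have e5 := h6 0
    have e6 := h6 1
    have e7 := h6 2
    have e8 := h6 3
    norm_num at e5 e6 e7 e8
    simp only [h1, one_mul, hη, Finset.prod_range_succ, Finset.prod_range_zero, ← pow_add]
    interval_cases i <;> norm_num [e5, e6, e7, e8] <;> ring
  · have hη1 : η ≠ 1 := by
      rintro rfl
      simp at hη
    have hne : ∀ i, χ ^ i * η ≠ 1 := by
      intro i hi
      refine hη ?_
      have := congrArg (· ^ 5) hi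
      simpa [mul_pow, ← pow_mul, mul_comm i 5, pow_mul χ 5, h5] using this
    have hP := gaussSum_pow_five_eq (φ := φ) hη h50 hζ
    rw [monicSum_evalHom_rootsOfUnity hχ hη1 hζ] at hP
    have hJ := fun i => jacobiSum_mul_nontrivial (hne i) φ
    have j1 := hJ 1
    have j2 := hJ 2
    have j3 := hJ 3
    have j4 := hJ 4
    rw [pow_one] at j1
    have hη5 : η 5 ≠ 0 := (h50.isUnit.map η).ne_zero
    have hG := gaussSum_ne_zero η hφ
    have hne0 : jacobiSum χ η * jacobiSum (χ ^ 2) η * jacobiSum (χ ^ 3) η *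
        jacobiSum (χ ^ 4) η ≠ 0 := by
      intro h0
      rw [h0, mul_zero] at hP
      exact mul_ne_zero (pow_ne_zero 5 hη5) (pow_ne_zero 5 hG) hP
    refine mul_right_cancel₀ hne0 ?_
    simp only [Finset.prod_range_succ, Finset.prod_range_zero, pow_zero, pow_one, one_mul]
    calc _ = gaussSum χ φ * gaussSum (χ ^ 2) φ * gaussSum (χ ^ 3) φ * gaussSum (χ ^ 4) φ *
          (η 5 ^ 5 * gaussSum η φ ^ 5) := by rw [hP]; ring
      _ = η 5 ^ 5 * gaussSum η φ * (gaussSum χ φ * gaussSum η φ) *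
          (gaussSum (χ ^ 2) φ * gaussSum η φ) * (gaussSum (χ ^ 3) φ * gaussSum η φ) *
          (gaussSum (χ ^ 4) φ * gaussSum η φ) := by ring
      _ = _ := by rw [← j1, ← j2, ← j3, ← j4]; ring

end HasseDavenport

section HypergeometricSum

variable {F : Type*} [Field F] [Fintype F]

theorem gaussSum'_eq_gaussSum (φ : AddChar F ℂ) (χ : MulChar F ℂ) :
    gaussSum' φ χ = gaussSum χ φ := by
  classical
  have h := Fintype.sum_eq_add_sum_subtype_ne (fun x => χ x * φ x) (0 : F)
  rw [MulChar.map_zero, zero_mul, zero_add] at h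
  rw [gaussSum', gaussSum, h, ← unitsEquivNeZero.sum_comp]
  exact Finset.sum_congr rfl fun x _ => mul_comm _ _

theorem sum_mulChar_apply [DecidableEq F] (a : F) :
    ∑ η : MulChar F ℂ, η a = if a = 1 then (Fintype.card F : ℂ) - 1 else 0 := by
  split_ifs with h
  · subst h
    have hc : Fintype.card (MulChar F ℂ) = Fintype.card F - 1 := by
      rw [← Nat.card_eq_fintype_card, MulChar.card_eq_card_units_of_hasEnoughRootsOfUnity,
        Nat.card_eq_fintype_card, Fintype.card_units]
    simp [hc, Nat.cast_sub (Fintype.card_pos (α := F))]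
  · obtain ⟨ξ, hξ⟩ := MulChar.exists_apply_ne_one_of_hasEnoughRootsOfUnity F ℂ h
    have hs : ∑ η : MulChar F ℂ, (ξ * η) a = ∑ η : MulChar F ℂ, η a :=
      Equiv.sum_comp (Equiv.mulLeft ξ) fun η => η a
    simp_rw [MulChar.mul_apply, ← Finset.mul_sum] at hs
    by_contra hne
    exact hξ (mul_right_cancel₀ hne (hs.trans (one_mul _).symm))

theorem inv_gaussSum_eq {φ : AddChar F ℂ} (hφ : φ ≠ 1) (ε : MulChar F ℂ)
    [Decidable (ε = 1)] :
    (if ε = 1 then 1 else (Fintype.card F : ℂ)) * (gaussSum ε φ)⁻¹ =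
      ε (-1) * gaussSum ε⁻¹ φ := by
  have hG := gaussSum_ne_zero ε hφ
  split_ifs with h
  · subst h
    rw [inv_one, gaussSum_one_left hφ, MulChar.one_apply isUnit_one.neg]
    norm_num
  · have h1 := gaussSum_mul_gaussSum_inv h hφ
    have h2 : ε (-1) * ε (-1) = 1 := by rw [← map_mul]; simp
    field_simp
    linear_combination (-ε (-1)) * h1 - (Fintype.card F : ℂ) * h2

theorem card_zpow_zNum [DecidableEq (MulChar F ℂ)] {χ : MulChar F ℂ} (hχ : orderOf χ = 5)
    (η : MulChar F ℂ) :
    (Fintype.card F : ℂ) ^ ((5 : ℤ) - zNum χ η ![0, 0, 1, 1, 3] - deltaNum χ η ![0, 0, 1, 1, 3]) =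
      (Fintype.card F : ℂ) ^ 2 * (if η = 1 then 1 else (Fintype.card F : ℂ)) *
        (if χ * η = 1 then 1 else (Fintype.card F : ℂ)) := by
  have hz : zNum χ η ![0, 0, 1, 1, 3] = 2 * (if η = 1 then 1 else 0) +
      2 * (if χ * η = 1 then 1 else 0) + if χ ^ 3 * η = 1 then 1 else 0 := by
    rw [zNum, Finset.card_filter, Fin.sum_univ_five]
    simp [zpow_ofNat]
    split_ifs <;> rfl
  have h1 : χ ^ 1 ≠ 1 := pow_ne_one_of_lt_orderOf (by norm_num) (by omega)
  have h2 : χ ^ 2 ≠ 1 := pow_ne_one_of_lt_orderOf (by norm_num) (by omega)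
  have h3 : χ ^ 3 ≠ 1 := pow_ne_one_of_lt_orderOf (by norm_num) (by omega)
  rw [pow_one] at h1
  rw [deltaNum, hz]
  by_cases hη : η = 1
  · subst hη
    simp [h1, h3]
    norm_cast
  by_cases hχη : χ * η = 1
  · have h3η : χ ^ 3 * η ≠ 1 := by
      rw [pow_succ, mul_assoc, hχη, mul_one]
      exact h2
    simp [hη, hχη, h3η]
    norm_cast
  · by_cases h3η : χ ^ 3 * η = 1
    · simp [hη, hχη, h3η]
      norm_cast
    · simp [hη, hχη, h3η]
      norm_cast

theorem Ntuple_term_eq {φ : AddChar F ℂ} (hφ : φ ≠ 1) {χ : MulChar F ℂ} (hχ : orderOf χ = 5)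
    (η : MulChar F ℂ) (ψ : F) :
    (Fintype.card F : ℂ) ^ ((5 : ℤ) - zNum χ η ![0, 0, 1, 1, 3] - deltaNum χ η ![0, 0, 1, 1, 3]) *
        gaussSum' φ (η ^ 5) / (∏ j : Fin 5, gaussSum' φ (χ ^ (![0, 0, 1, 1, 3] j : ℤ) * η)) *
        η ((((5 : F) * ψ) ^ 5)⁻¹) =
      Fintype.card F * (jacobiSum (χ ^ 2 * η) (χ * η)⁻¹ * jacobiSum (χ ^ 4 * η) η⁻¹ *
        η ((ψ ^ 5)⁻¹)) := by
  classical
  obtain ⟨ζ, hζ⟩ := exists_isPrimitiveRoot_orderOf χ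
  rw [hχ] at hζ
  have h50 : (5 : F) ≠ 0 := by
    have := hζ.neZero'
    exact_mod_cast this.out
  have hη5 : η 5 ≠ 0 := (h50.isUnit.map η).ne_zero
  have hχ5 : χ ^ 5 = 1 := hχ ▸ pow_orderOf_eq_one χ
  have h1 : χ ^ 1 ≠ 1 := pow_ne_one_of_lt_orderOf (by norm_num) (by omega)
  have h4 : χ ^ 4 ≠ 1 := pow_ne_one_of_lt_orderOf (by norm_num) (by omega)
  rw [pow_one] at h1
  have hprod : ∏ j : Fin 5, gaussSum' φ (χ ^ (![0, 0, 1, 1, 3] j : ℤ) * η) =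
      gaussSum η φ ^ 2 * gaussSum (χ * η) φ ^ 2 * gaussSum (χ ^ 3 * η) φ := by
    simp_rw [gaussSum'_eq_gaussSum]
    rw [Fin.prod_univ_five]
    change gaussSum (χ ^ (0 : ℤ) * η) φ * gaussSum (χ ^ (0 : ℤ) * η) φ *
      gaussSum (χ ^ (1 : ℤ) * η) φ * gaussSum (χ ^ (1 : ℤ) * η) φ *
      gaussSum (χ ^ (3 : ℤ) * η) φ = _
    rw [zpow_zero, zpow_one, one_mul, zpow_ofNat]
    ring
  have hval : η ((((5 : F) * ψ) ^ 5)⁻¹) = (η 5 ^ 5)⁻¹ * η ((ψ ^ 5)⁻¹) := by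
    rw [mul_pow, mul_inv, map_mul, ← inv_pow, map_pow, ← MulChar.inv_apply',
      MulChar.inv_apply_eq_inv', inv_pow]
  have hHD := card_sq_mul_gaussSum_pow_five hφ hχ η
  simp only [Finset.prod_range_succ, Finset.prod_range_zero, pow_zero, pow_one, one_mul] at hHD
  have i1 := inv_gaussSum_eq hφ η
  have i2 := inv_gaussSum_eq hφ (χ * η)
  have hsign : η (-1) * (χ * η) (-1) = 1 := by
    rw [MulChar.mul_apply, apply_neg_one_of_orderOf_eq_five hχ, one_mul, ← map_mul]
    simp
  have e1 : χ ^ 2 * η * (χ * η)⁻¹ = χ := by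
    rw [mul_inv_rev, mul_assoc, mul_inv_cancel_left, pow_two, mul_inv_cancel_right]
  have e2 : χ ^ 4 * η * η⁻¹ = χ ^ 4 := mul_inv_cancel_right _ _
  have j1 := jacobiSum_mul_nontrivial (e1.trans_ne h1) φ
  have j2 := jacobiSum_mul_nontrivial (e2.trans_ne h4) φ
  rw [e1] at j1
  rw [e2] at j2
  have hq : gaussSum χ φ * gaussSum (χ ^ 4) φ = Fintype.card F := by
    rw [show χ ^ 4 = χ⁻¹ from eq_inv_of_mul_eq_one_left (by rw [← pow_succ, hχ5]),
      gaussSum_mul_gaussSum_inv h1 hφ, apply_neg_one_of_orderOf_eq_five hχ, one_mul]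
  rw [card_zpow_zNum hχ, hprod, hval, gaussSum'_eq_gaussSum]
  have g0 := gaussSum_ne_zero η hφ
  have g1 := gaussSum_ne_zero (χ * η) hφ
  have g3 := gaussSum_ne_zero (χ ^ 3 * η) hφ
  set r := if η = 1 then 1 else (Fintype.card F : ℂ)
  set r' := if χ * η = 1 then 1 else (Fintype.card F : ℂ)
  calc _ = (Fintype.card F : ℂ) ^ 2 * gaussSum (η ^ 5) φ * (η 5 ^ 5)⁻¹ * r * r' /
        (gaussSum η φ ^ 2 * gaussSum (χ * η) φ ^ 2 * gaussSum (χ ^ 3 * η) φ) * η ((ψ ^ 5)⁻¹) := by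
        ring
    _ = (r * (gaussSum η φ)⁻¹) * (r' * (gaussSum (χ * η) φ)⁻¹) * gaussSum (χ ^ 2 * η) φ *
        gaussSum (χ ^ 4 * η) φ * η ((ψ ^ 5)⁻¹) := by
        rw [hHD]
        field_simp
    _ = η (-1) * (χ * η) (-1) * (gaussSum (χ ^ 2 * η) φ * gaussSum (χ * η)⁻¹ φ) *
        (gaussSum (χ ^ 4 * η) φ * gaussSum η⁻¹ φ) * η ((ψ ^ 5)⁻¹) := by
        rw [i1, i2]
        ring
    _ = _ := by
        rw [hsign, ← j1, ← j2, ← hq]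
        ring

theorem sum_jacobiSum_mul_jacobiSum {χ : MulChar F ℂ} (hχ : orderOf χ = 5) {lam : F}
    (hlam : lam ≠ 0) :
    ∑ η : MulChar F ℂ, jacobiSum (χ ^ 2 * η) (χ * η)⁻¹ * jacobiSum (χ ^ 4 * η) η⁻¹ * η lam =
      ((Fintype.card F : ℂ) - 1) * NcurvePsi 2 4 lam χ := by
  classical
  have hterm : ∀ η : MulChar F ℂ,
      jacobiSum (χ ^ 2 * η) (χ * η)⁻¹ * jacobiSum (χ ^ 4 * η) η⁻¹ * η lam =
      ∑ p : F × F, (χ ^ 2) p.1 * χ (1 - p.1)⁻¹ * (χ ^ 4) p.2 *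
        η (lam * p.1 * p.2 * (1 - p.1)⁻¹ * (1 - p.2)⁻¹) := by
    intro η
    rw [jacobiSum, jacobiSum, Finset.sum_mul_sum, ← Finset.univ_product_univ, Finset.sum_product,
      Finset.sum_mul]
    refine Finset.sum_congr rfl fun x _ => ?_
    rw [Finset.sum_mul]
    refine Finset.sum_congr rfl fun y _ => ?_
    simp only [MulChar.mul_apply, MulChar.inv_apply', map_mul]
    ring
  simp_rw [hterm]
  rw [Finset.sum_comm]
  simp_rw [← Finset.mul_sum, sum_mulChar_apply, mul_ite, mul_zero]
  rw [← Finset.sum_filter, ← Finset.sum_mul, mul_comm]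
  congr 1
  have hχ5 : χ ^ 5 = 1 := hχ ▸ pow_orderOf_eq_one χ
  have hdom : ∀ x y : F, lam * x * y * (1 - x)⁻¹ * (1 - y)⁻¹ = 1 ↔
      x ≠ 0 ∧ x ≠ 1 ∧ y ≠ 0 ∧ y ≠ 1 ∧ lam * x * y = (1 - x) * (1 - y) := by
    intro x y
    constructor
    · intro h
      have hx1 : x ≠ 1 := by
        rintro rfl
        simp at h
      have hy1 : y ≠ 1 := by
        rintro rfl
        simp at h
      refine ⟨by rintro rfl; simp at h, hx1, by rintro rfl; simp at h, hy1, ?_⟩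
      have hx1' : 1 - x ≠ 0 := sub_ne_zero.2 hx1.symm
      have hy1' : 1 - y ≠ 0 := sub_ne_zero.2 hy1.symm
      field_simp at h
      exact h
    · rintro ⟨hx0, hx1, hy0, hy1, h⟩
      have hx1' : 1 - x ≠ 0 := sub_ne_zero.2 hx1.symm
      have hy1' : 1 - y ≠ 0 := sub_ne_zero.2 hy1.symm
      field_simp
      exact h
  have hdiv : ∀ x y : F, x ≠ 1 → lam * x * y = (1 - x) * (1 - y) →
      (1 - lam * (x / (x - 1)))⁻¹ = y := by
    intro x y hx1 h
    have hx1' : x - 1 ≠ 0 := sub_ne_zero.2 hx1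
    refine inv_eq_of_mul_eq_one_right ?_
    field_simp
    linear_combination -h
  have hinvol : ∀ x : F, x ≠ 1 → x / (x - 1) / (x / (x - 1) - 1) = x := by
    intro x hx1
    have hx1' : x - 1 ≠ 0 := sub_ne_zero.2 hx1
    have : x / (x - 1) - 1 = (x - 1)⁻¹ := by
      field_simp
      ring
    rw [this, div_inv_eq_mul, div_mul_cancel₀ _ hx1']
  refine Finset.sum_bij' (fun p _ => p.1 / (p.1 - 1))
    (fun u _ => (u / (u - 1), (1 - lam * u)⁻¹)) ?_ ?_ ?_ ?_ ?_
  · rintro ⟨x, y⟩ hp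
    obtain ⟨hx0, hx1, hy0, hy1, h⟩ := (hdom x y).1 (Finset.mem_filter.1 hp).2
    have hx1' : x - 1 ≠ 0 := sub_ne_zero.2 hx1
    refine Finset.mem_filter.2 ⟨Finset.mem_univ _, div_ne_zero hx0 hx1', fun hc => ?_, fun hc => ?_⟩
    · rw [div_eq_one_iff_eq hx1'] at hc
      exact one_ne_zero (by linear_combination hc : (1 : F) = 0)
    · have hy := hdiv x y hx1 h
      simp only [hc, mul_inv_cancel₀ hlam, sub_self, inv_zero] at hy
      exact hy0 hy.symm
  · intro u hu
    obtain ⟨hu0, hu1, hul⟩ := (Finset.mem_filter.1 hu).2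
    have hu1' : u - 1 ≠ 0 := sub_ne_zero.2 hu1
    have hul' : 1 - lam * u ≠ 0 := fun hc =>
      hul (eq_inv_of_mul_eq_one_right (sub_eq_zero.1 hc).symm)
    refine Finset.mem_filter.2 ⟨Finset.mem_univ _, (hdom _ _).2 ⟨div_ne_zero hu0 hu1', fun hc => ?_,
      inv_ne_zero hul', fun hc => ?_, ?_⟩⟩
    · rw [div_eq_one_iff_eq hu1'] at hc
      exact one_ne_zero (by linear_combination hc : (1 : F) = 0)
    · rw [inv_eq_one] at hc
      exact mul_ne_zero hlam hu0 (by linear_combination -hc)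
    · field_simp
      ring
  · rintro ⟨x, y⟩ hp
    obtain ⟨hx0, hx1, hy0, hy1, h⟩ := (hdom x y).1 (Finset.mem_filter.1 hp).2
    exact Prod.ext (hinvol x hx1) (hdiv x y hx1 h)
  · intro u hu
    exact hinvol u (Finset.mem_filter.1 hu).2.2.1
  · rintro ⟨x, y⟩ hp
    obtain ⟨hx0, hx1, hy0, hy1, h⟩ := (hdom x y).1 (Finset.mem_filter.1 hp).2
    have hx1' : x - 1 ≠ 0 := sub_ne_zero.2 hx1
    have hx1'' : 1 - x ≠ 0 := sub_ne_zero.2 hx1.symm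
    have h1 : 1 - x / (x - 1) = (1 - x)⁻¹ := by
      refine eq_inv_of_mul_eq_one_left ?_
      field_simp
      ring
    have h2 : x / (x - 1) = -1 * x * (1 - x)⁻¹ := by
      rw [← neg_sub 1 x, div_neg, div_eq_mul_inv]
      ring
    have h3 : (χ ^ 2) (-1) = 1 := by
      rw [MulChar.pow_apply' _ (by norm_num), apply_neg_one_of_orderOf_eq_five hχ, one_pow]
    have h4 : (χ ^ 2) (1 - x)⁻¹ * (χ ^ 4) (1 - x)⁻¹ = χ (1 - x)⁻¹ := by
      rw [← MulChar.mul_apply, ← pow_add, pow_succ χ 5, hχ5, one_mul]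
    have h5 : (χ ^ (-(4 : ℕ) : ℤ)) (1 - lam * (x / (x - 1))) = (χ ^ 4) y := by
      rw [zpow_neg, zpow_natCast, MulChar.inv_apply', hdiv x y hx1 h]
    simp only
    rw [h5, h1, h2, map_mul, map_mul, h3, ← h4]
    ring

theorem Ntuple_eq_card_mul_NcurvePsi {φ : AddChar F ℂ} (hφ : φ ≠ 1) {χ : MulChar F ℂ}
    (hχ : orderOf χ = 5) {ψ : F} (hψ : ψ ≠ 0) :
    Ntuple φ χ ψ ![0, 0, 1, 1, 3] = (Fintype.card F : ℂ) * NcurvePsi 2 4 ((ψ ^ 5)⁻¹) χ := by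
  have hq : (Fintype.card F : ℂ) - 1 ≠ 0 :=
    sub_ne_zero.2 (Nat.cast_ne_one.2 Fintype.one_lt_card.ne')
  rw [Ntuple, Finset.sum_congr rfl fun η _ => Ntuple_term_eq hφ hχ η ψ, ← Finset.mul_sum,
    sum_jacobiSum_mul_jacobiSum hχ (inv_ne_zero (pow_ne_zero 5 hψ))]
  field_simp

theorem Ntuple_pow_two (φ : AddChar F ℂ) {χ : MulChar F ℂ} (hχ : orderOf χ = 5) (ψ : F) :
    Ntuple φ χ ψ ![0, 0, 1, 2, 2] = Ntuple φ (χ ^ 2) ψ ![0, 0, 1, 1, 3] := by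
  have hperm : ∀ j : Fin 5, (χ ^ 2) ^ (![0, 0, 1, 1, 3] j : ℤ) =
      χ ^ (![0, 0, 1, 2, 2] (Equiv.swap (2 : Fin 5) 4 j) : ℤ) := by
    have hχ6 : χ ^ (2 * 3) = χ := by
      rw [pow_succ, ← hχ, pow_orderOf_eq_one, one_mul]
    intro j
    fin_cases j
    · rfl
    · rfl
    · exact (zpow_one _).trans (zpow_ofNat _ _).symm
    · exact (zpow_one _).trans (zpow_ofNat _ _).symm
    · exact (zpow_ofNat _ _).trans (((pow_mul _ _ _).symm.trans hχ6).trans (zpow_one _).symm)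
  have hz : ∀ η, zNum χ η ![0, 0, 1, 2, 2] = zNum (χ ^ 2) η ![0, 0, 1, 1, 3] := by
    intro η
    simp_rw [zNum, Finset.card_filter]
    rw [← Equiv.sum_comp (Equiv.swap (2 : Fin 5) 4)]
    simp_rw [hperm]
    exact Finset.sum_congr rfl fun j _ => by congr
  have hprod : ∀ η, ∏ j : Fin 5, gaussSum' φ (χ ^ (![0, 0, 1, 2, 2] j : ℤ) * η) =
      ∏ j : Fin 5, gaussSum' φ ((χ ^ 2) ^ (![0, 0, 1, 1, 3] j : ℤ) * η) := by
    intro η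
    rw [← Equiv.prod_comp (Equiv.swap (2 : Fin 5) 4)]
    simp_rw [hperm]
  simp_rw [Ntuple, deltaNum, hz, hprod]

end HypergeometricSum

/-- Let `F` be a finite field with `q ≡ 1 (mod 5)` elements of
characteristic `p ≠ 5`, let `ψ ∈ F*`, set `λ = ψ⁻⁵`, and let `χ` be a multiplicative
character of `F` of order `5`. With
`N(B_ψ, χ') = ∑_{x ≠ 0, 1, 1/λ} χ'²(x) χ'⁴(1-x) χ'⁻⁴(1-λx)`, we have
`N_{(0,0,1,1,3),χ}(q) = q N(B_ψ, χ)` and `N_{(0,0,1,2,2),χ}(q) = q N(B_ψ, χ²)`. -/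
theorem stmt_18 {F : Type*} [Field F] [Fintype F] (hchar : ringChar F ≠ 5)
    (hq : Fintype.card F % 5 = 1) (ψ : F) (hψ : ψ ≠ 0)
    (φ : AddChar F ℂ) (hφ : φ ≠ 1) (χ : MulChar F ℂ) (hχ : orderOf χ = 5) :
    Ntuple φ χ ψ ![0, 0, 1, 1, 3] =
        (Fintype.card F : ℂ) * NcurvePsi 2 4 ((ψ ^ 5)⁻¹) χ ∧
      Ntuple φ χ ψ ![0, 0, 1, 2, 2] =
        (Fintype.card F : ℂ) * NcurvePsi 2 4 ((ψ ^ 5)⁻¹) (χ ^ 2) := by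
  have hχ2 : orderOf (χ ^ 2) = 5 := by
    rw [orderOf_pow' χ two_ne_zero, hχ]
    norm_num
  exact ⟨Ntuple_eq_card_mul_NcurvePsi hφ hχ hψ, by
    rw [Ntuple_pow_two φ hχ, Ntuple_eq_card_mul_NcurvePsi hφ hχ2 hψ]⟩
end

section
/- Let q ≡ 1 (mod 5). Then the number of pairs (x,y) ∈ F_q × F_q with y^5 = x^2(1−x)^5 equals q − 4. -/
/-- A field with `q ≡ 1 (mod 5)` elements contains exactly five fifth roots of unity. -/
theorem card_filter_pow_five_eq_one {F : Type*} [Field F] [Fintype F] [DecidableEq F]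
    (hq : Fintype.card F % 5 = 1) :
    (Finset.univ.filter fun t : F => t ^ 5 = 1).card = 5 := by
  have : Fact (Nat.Prime 5) := ⟨by norm_num⟩
  have hdvd : 5 ∣ Fintype.card Fˣ := by
    rw [Fintype.card_units]
    omega
  obtain ⟨u, hu⟩ := exists_prime_orderOf_dvd_card 5 hdvd
  have hζ : IsPrimitiveRoot (u : F) 5 := by
    rw [IsPrimitiveRoot.coe_units_iff, ← hu]
    exact IsPrimitiveRoot.orderOf u
  refine Eq.trans (congrArg Finset.card ?_) hζ.card_nthRootsFinset
  ext t
  simp [Polynomial.mem_nthRootsFinset]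

/-- The parametrization `t ↦ (t⁵, t²(1 - t⁵))` of the curve `y⁵ = x²(1-x)⁵` is injective away from
the fifth roots of unity. -/
theorem injOn_quintic_parametrization {F : Type*} [Field F] :
    Set.InjOn (fun t : F => (t ^ 5, t ^ 2 * (1 - t ^ 5))) {t | t ^ 5 ≠ 1} := by
  intro t ht s hs h
  obtain ⟨h₁, h₂⟩ := Prod.mk.inj h
  have hne : 1 - t ^ 5 ≠ 0 := sub_ne_zero.mpr (Ne.symm ht)
  rw [← h₁] at h₂
  have hsq : t ^ 2 = s ^ 2 := mul_right_cancel₀ hne h₂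
  rcases eq_or_ne t 0 with rfl | ht0
  · exact (pow_eq_zero_iff two_ne_zero).mp (by simpa using hsq.symm) |>.symm
  · refine mul_right_cancel₀ (pow_ne_zero 4 ht0) ?_
    linear_combination h₁ - s * (t ^ 2 + s ^ 2) * hsq

/-- Every point of `y⁵ = x²(1-x)⁵` with `x ≠ 1` is of the form `(t⁵, t²(1 - t⁵))`. -/
theorem exists_quintic_parameter {F : Type*} [Field F] {x y : F} (hx : x ≠ 1)
    (h : y ^ 5 = x ^ 2 * (1 - x) ^ 5) : ∃ t : F, t ^ 5 = x ∧ t ^ 2 * (1 - t ^ 5) = y := by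
  have hne : 1 - x ≠ 0 := sub_ne_zero.mpr hx.symm
  rcases eq_or_ne x 0 with rfl | hx0
  · exact ⟨0, by simp, by simp_all⟩
  obtain ⟨z, rfl⟩ : ∃ z, y = z * (1 - x) := ⟨y / (1 - x), by field_simp⟩
  have hz : z ^ 5 = x ^ 2 := mul_right_cancel₀ (pow_ne_zero 5 hne) (by rw [← mul_pow, h])
  have hz0 : z ≠ 0 := by
    rintro rfl
    exact hx0 ((pow_eq_zero_iff two_ne_zero).mp (by simpa using hz.symm))
  have h5 : (x / z ^ 2) ^ 5 = x := by
    rw [div_pow, div_eq_iff (pow_ne_zero 5 (pow_ne_zero 2 hz0))]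
    linear_combination -x * (z ^ 5 + x ^ 2) * hz
  have h2 : (x / z ^ 2) ^ 2 = z := by
    rw [div_pow, div_eq_iff (pow_ne_zero 2 (pow_ne_zero 2 hz0))]
    linear_combination -hz
  exact ⟨x / z ^ 2, h5, by rw [h5, h2]⟩

/-- Let `F` be a finite field with `q` elements of characteristic `p ≠ 5`.
If `q ≡ 1 (mod 5)`, then the number of pairs `(x, y) ∈ F × F` with
`y^5 = x²(1-x)⁵` equals `q - 4`. -/
theorem stmt_19 {F : Type*} [Field F] [Fintype F] (hchar : ringChar F ≠ 5)
    (hq : Fintype.card F % 5 = 1) :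
    Nat.card {pt : F × F // pt.2 ^ 5 = pt.1 ^ 2 * (1 - pt.1) ^ 5} =
      Fintype.card F - 4 := by
  classical
  have hset : (Finset.univ.filter fun pt : F × F => pt.2 ^ 5 = pt.1 ^ 2 * (1 - pt.1) ^ 5) =
      insert (1, 0) ((Finset.univ.filter fun t : F => t ^ 5 ≠ 1).image
        fun t => (t ^ 5, t ^ 2 * (1 - t ^ 5))) := by
    ext ⟨x, y⟩
    simp only [Finset.mem_filter, Finset.mem_univ, true_and, Finset.mem_insert, Finset.mem_image,
      Prod.mk.injEq]
    constructor
    · intro h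
      rcases eq_or_ne x 1 with rfl | hx
      · exact Or.inl ⟨rfl, by simpa using h⟩
      · obtain ⟨t, rfl, hy⟩ := exists_quintic_parameter hx h
        exact Or.inr ⟨t, hx, rfl, hy⟩
    · rintro (⟨rfl, rfl⟩ | ⟨t, -, rfl, rfl⟩)
      · simp
      · ring
  have hcount := Finset.card_filter_add_card_filter_not (s := Finset.univ)
    fun t : F => t ^ 5 = 1
  rw [card_filter_pow_five_eq_one hq, Finset.card_univ] at hcount
  rw [Nat.card_eq_fintype_card, Fintype.card_subtype, hset, Finset.card_insert_of_notMem,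
    Finset.card_image_of_injOn]
  · simp only [ne_eq]
    omega
  · simpa using injOn_quintic_parametrization (F := F)
  · simp only [Finset.mem_image, Finset.mem_filter, Prod.mk.injEq]
    rintro ⟨t, ⟨-, ht⟩, h, -⟩
    exact ht h
end
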